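/- There is a universal constant C ≥ 3 such that every linear hypergraph H with n vertices, no rank-1 edges, maximum rank P ≥ C and maximum degree Δ ≥ C(P − 1) which is either uniform or satisfies n > Δ(P − 1) has q_list(H) ≤ n − 1. -/

import Mathlib

open Finset

variable {V : Type*} [DecidableEq V]

/-- A proper list edge coloring of the hypergraph with edge set `E` from the lists `L`:
each edge gets a color from its list, and two distinct edges get the same color
only if they are disjoint. -/
def IsProperListColoring (E : Finset (Finset V)) (L : Finset V → Finset ℕ)
    (γ : Finset V → ℕ) : Prop :=
  (∀ e ∈ E, γ e ∈ L e) ∧ ∀ e ∈ E, ∀ f ∈ E, e ≠ f → γ e = γ f → Disjoint e f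

/-- `E` is `k`-list-edge-colorable: for every assignment of lists of size `k`
there is a proper list edge coloring. -/
def ListColorable (E : Finset (Finset V)) (k : ℕ) : Prop :=
  ∀ L : Finset V → Finset ℕ, (∀ e ∈ E, (L e).card = k) →
    ∃ γ : Finset V → ℕ, IsProperListColoring E L γ

/-- The list edge chromatic number `q_list`: the least `k` such that `E` is
`k`-list-edge-colorable. -/
noncomputable def qList (E : Finset (Finset V)) : ℕ :=
  sInf {k | ListColorable E k}

/-- The degree of a vertex: the number of edges containing it. -/
def deg (E : Finset (Finset V)) (x : V) : ℕ := (E.filter fun e => x ∈ e).card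

/-- The clique rank of an edge: `R(e) = ∑_{x ∈ e} (d(x) - 1)`. -/
def cliqueRank (E : Finset (Finset V)) (e : Finset V) : ℕ :=
  ∑ x ∈ e, (deg E x - 1)

/-- The clique degree of a vertex: `D(x) = ∑_{e ∋ x} (r(e) - 1)`. -/
def cliqueDeg (E : Finset (Finset V)) (x : V) : ℕ :=
  ∑ e ∈ E.filter (fun e => x ∈ e), (e.card - 1)

/-- A hypergraph is linear if any two distinct edges meet in at most one vertex. -/
def Linear (E : Finset (Finset V)) : Prop :=
  ∀ e ∈ E, ∀ f ∈ E, e ≠ f → (e ∩ f).card ≤ 1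

/-- The number of triangles with side `e`: unordered pairs `{f, g}` of edges
distinct from `e` such that `e, f, g` pairwise intersect. -/
def numTriangles (E : Finset (Finset V)) (e : Finset V) : ℕ :=
  (((E.erase e).powersetCard 2).filter fun p =>
    (∀ f ∈ p, (e ∩ f).Nonempty) ∧ ∀ f ∈ p, ∀ g ∈ p, f ≠ g → (f ∩ g).Nonempty).card

/-! ### List colorings of locally sparse graphs -/

section LocallySparse

variable {α : Type*} [Fintype α] [DecidableEq α] (G : SimpleGraph α) [DecidableRel G.Adj]
  (L : α → Finset ℕ)

/-- The colors in the list of `u` that `c` uses on no neighbor of `u` in `S`. -/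
def avail (S : Finset α) (c : α → ℕ) (u : α) : Finset ℕ :=
  (L u).filter fun x => ∀ w ∈ S, G.Adj w u → c w ≠ x

/-- The proper list colorings of the subgraph induced on `S`, extended by `0` outside `S`. -/
def colorings (S : Finset α) : Finset (α → ℕ) :=
  (Fintype.piFinset fun u => if u ∈ S then L u else {0}).filter fun c =>
    ∀ u ∈ S, ∀ w ∈ S, G.Adj u w → c u ≠ c w

variable {G L}

lemma mem_avail {S : Finset α} {c : α → ℕ} {u : α} {x : ℕ} :
    x ∈ avail G L S c u ↔ x ∈ L u ∧ ∀ w ∈ S, G.Adj w u → c w ≠ x := by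
  simp [avail]

lemma mem_colorings {S : Finset α} {c : α → ℕ} :
    c ∈ colorings G L S ↔ ((∀ u ∈ S, c u ∈ L u) ∧ ∀ u ∉ S, c u = 0) ∧
      ∀ u ∈ S, ∀ w ∈ S, G.Adj u w → c u ≠ c w := by
  simp only [colorings, mem_filter, Fintype.mem_piFinset]
  refine and_congr_left fun _ => ⟨fun h => ⟨fun u hu => ?_, fun u hu => ?_⟩, fun h u => ?_⟩
  · simpa [hu] using h u
  · simpa [hu] using h u
  · by_cases hu : u ∈ S
    · simpa [hu] using h.1 u hu
    · simpa [hu] using h.2 u hu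

lemma avail_update {S : Finset α} {a : α} (ha : a ∉ S) (c : α → ℕ) (y : ℕ) (u : α) :
    avail G L S (Function.update c a y) u = avail G L S c u := by
  refine filter_congr fun x _ => forall₂_congr fun w hw => ?_
  rw [Function.update_of_ne (ne_of_mem_of_not_mem hw ha)]

lemma avail_anti {S T : Finset α} (h : S ⊆ T) (c : α → ℕ) (u : α) :
    avail G L T c u ⊆ avail G L S c u := fun x hx => by
  rw [mem_avail] at hx ⊢
  exact ⟨hx.1, fun w hw => hx.2 w (h hw)⟩

lemma sum_colorings_insert {S : Finset α} {v : α} (hv : v ∉ S) (h : (α → ℕ) → ℝ) :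
    ∑ c ∈ colorings G L (insert v S), h c =
      ∑ b ∈ colorings G L S, ∑ y ∈ avail G L S b v, h (Function.update b v y) := by
  rw [Finset.sum_sigma']
  refine Finset.sum_bij' (fun c _ => ⟨Function.update c v 0, c v⟩)
    (fun p _ => Function.update p.1 v p.2) ?_ ?_ ?_ ?_ ?_
  · intro c hc
    rw [mem_colorings] at hc
    obtain ⟨⟨h1, h2⟩, h3⟩ := hc
    have hne : ∀ u ∈ S, u ≠ v := fun u hu => ne_of_mem_of_not_mem hu hv
    simp only [mem_sigma, avail_update hv, mem_avail, mem_colorings]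
    refine ⟨⟨⟨fun u hu => ?_, fun u hu => ?_⟩, fun u hu w hw huw => ?_⟩, h1 v (by simp),
      fun w hw hwv => h3 w (by simp [hw]) v (by simp) hwv⟩
    · rw [Function.update_of_ne (hne u hu)]
      exact h1 u (by simp [hu])
    · by_cases huv : u = v
      · simp [huv]
      · rw [Function.update_of_ne huv]
        exact h2 u (by simp [hu, huv])
    · rw [Function.update_of_ne (hne u hu), Function.update_of_ne (hne w hw)]
      exact h3 u (by simp [hu]) w (by simp [hw]) huw
  · rintro ⟨b, y⟩ hp
    simp only [mem_sigma, mem_avail, mem_colorings] at hp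
    obtain ⟨⟨⟨h1, h2⟩, h3⟩, h4, h5⟩ := hp
    have hne : ∀ u ∈ S, u ≠ v := fun u hu => ne_of_mem_of_not_mem hu hv
    rw [mem_colorings]
    refine ⟨⟨fun u hu => ?_, fun u hu => ?_⟩, fun u hu w hw huw => ?_⟩
    · rcases mem_insert.1 hu with rfl | hu
      · simpa using h4
      · rw [Function.update_of_ne (hne u hu)]
        exact h1 u hu
    · rw [mem_insert, not_or] at hu
      rw [Function.update_of_ne hu.1]
      exact h2 u hu.2
    · rcases mem_insert.1 hu with rfl | huS <;> rcases mem_insert.1 hw with rfl | hwS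
      · exact absurd huw (G.loopless.irrefl _)
      · rw [Function.update_self, Function.update_of_ne (hne w hwS)]
        exact (h5 w hwS huw.symm).symm
      · rw [Function.update_self, Function.update_of_ne (hne u huS)]
        exact h5 u huS huw
      · rw [Function.update_of_ne (hne u huS), Function.update_of_ne (hne w hwS)]
        exact h3 u huS w hwS huw
  · intro c _
    simp
  · rintro ⟨b, y⟩ hp
    simp only [mem_sigma, mem_colorings] at hp
    have : b v = 0 := hp.1.1.2 v hv
    simp [← this]
  · intro c _
    simp

lemma sum_colorings_erase {S : Finset α} {u : α} (hu : u ∈ S) (h : (α → ℕ) → ℝ) :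
    ∑ c ∈ colorings G L S, h c = ∑ b ∈ colorings G L (S.erase u),
      ∑ y ∈ avail G L (S.erase u) b u, h (Function.update b u y) := by
  rw [← sum_colorings_insert (notMem_erase u S), insert_erase hu]

lemma card_colorings_insert {S : Finset α} {v : α} (hv : v ∉ S) :
    ((colorings G L (insert v S)).card : ℝ) =
      ∑ c ∈ colorings G L S, ((avail G L S c v).card : ℝ) := by
  simpa using sum_colorings_insert (G := G) (L := L) hv fun _ => 1

/-- Few colorings leave only few colors available at a given vertex. -/
lemma sum_short_le {S O : Finset α} {u : α} (hu : u ∈ S) (hO : O ⊆ S.erase u) {t : ℝ}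
    (ht : 0 ≤ t) :
    ∑ c ∈ colorings G L S, (if t < (avail G L O c u).card then (0 : ℝ) else 1) ≤
      t * (colorings G L (S.erase u)).card := by
  have huO : u ∉ O := fun h => notMem_erase u S (hO h)
  rw [sum_colorings_erase hu, mul_comm, ← nsmul_eq_mul]
  refine sum_le_card_nsmul _ _ _ fun b _ => ?_
  simp only [avail_update huO, sum_const, nsmul_eq_mul]
  split_ifs with h
  · simpa using ht
  · have : ((avail G L (S.erase u) b u).card : ℝ) ≤ (avail G L O b u).card := by
      exact_mod_cast card_le_card (avail_anti hO b u)
    linarith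

/-- Upper bound for the probability that `u` gets color `x` (up to the factor `4`), given the
colors on `O`, if more than `t` colors are available at `u`. -/
noncomputable def colorWeight (G : SimpleGraph α) [DecidableRel G.Adj] (L : α → Finset ℕ)
    (O : Finset α) (t : ℝ) (x : ℕ) (c : α → ℕ) (u : α) : ℝ :=
  if t < (avail G L O c u).card ∧ x ∈ avail G L O c u then 4 / (avail G L O c u).card else 0

/-- The indicator that `c` does not use `x` at `u`, or that at most `t` colors are available
at `u` given the colors on `O`. -/
noncomputable def avoids (G : SimpleGraph α) [DecidableRel G.Adj] (L : α → Finset ℕ)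
    (O : Finset α) (t : ℝ) (x : ℕ) (c : α → ℕ) (u : α) : ℝ :=
  if t < (avail G L O c u).card ∧ c u = x then 0 else 1

lemma exp_neg_le_one_sub_half {z : ℝ} (h0 : 0 ≤ z) (h1 : z ≤ 1) :
    Real.exp (-z) ≤ 1 - z / 2 := by
  rw [Real.exp_neg, inv_le_comm₀ (Real.exp_pos _) (by linarith)]
  refine le_trans ?_ (Real.add_one_le_exp z)
  rw [inv_le_iff_one_le_mul₀ (by linarith)]
  nlinarith

/-- Resampling the color of a single vertex `u`. -/
lemma sum_mul_exp_le_sum_mul_avoids {S O : Finset α} {u : α} (hu : u ∈ S) (hO : O ⊆ S.erase u)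
    {t : ℝ} (ht : 4 ≤ t) {d : ℕ} (hdt : 2 * (d : ℝ) ≤ t)
    (hd : ((S \ O).filter (G.Adj u)).card ≤ d) (x : ℕ) (g : (α → ℕ) → ℝ) (hg : ∀ c, 0 ≤ g c)
    (hgu : ∀ c y, g (Function.update c u y) = g c) :
    ∑ c ∈ colorings G L S, g c * Real.exp (-colorWeight G L O t x c u) ≤
      ∑ c ∈ colorings G L S, g c * avoids G L O t x c u := by
  have huO : u ∉ O := fun h => notMem_erase u S (hO h)
  rw [sum_colorings_erase hu, sum_colorings_erase hu]
  refine sum_le_sum fun b _ => ?_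
  simp only [hgu, colorWeight, avoids, avail_update huO, Function.update_self]
  rw [← mul_sum, ← mul_sum]
  refine mul_le_mul_of_nonneg_left ?_ (hg b)
  set A := avail G L (S.erase u) b u with hA
  set B := avail G L O b u with hB
  have hAB : A ⊆ B := avail_anti hO b u
  by_cases ht' : t < B.card
  swap
  · simp [ht']
  by_cases hx : x ∈ A
  swap
  · have h1 : ∀ y ∈ A, (if t < (B.card : ℝ) ∧ y = x then (0 : ℝ) else 1) = 1 := by
      intro y hy
      rw [if_neg]
      rintro ⟨-, rfl⟩
      exact hx hy
    rw [sum_congr rfl h1]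
    refine sum_le_sum fun y _ => ?_
    rw [Real.exp_le_one_iff, neg_nonpos]
    split_ifs <;> positivity
  have hcard : B.card ≤ A.card + d := by
    have hsub : B ⊆ A ∪ ((S \ O).filter (G.Adj u)).image b := by
      intro y hy
      by_contra hcon
      rw [mem_union, not_or] at hcon
      refine hcon.1 (mem_avail.2 ⟨(mem_avail.1 hy).1, fun w hw hwu hwy => hcon.2 ?_⟩)
      refine mem_image.2 ⟨w, mem_filter.2 ⟨mem_sdiff.2 ⟨mem_of_mem_erase hw, fun hwO => ?_⟩,
        hwu.symm⟩, hwy⟩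
      exact (mem_avail.1 hy).2 w hwO hwu hwy
    exact (card_le_card hsub).trans ((card_union_le _ _).trans
      (Nat.add_le_add_left (card_image_le.trans hd) _))
  have hcard' : (B.card : ℝ) ≤ A.card + d := by exact_mod_cast hcard
  have hm : (0 : ℝ) < B.card := by linarith
  have hR : ∑ y ∈ A, (if t < (B.card : ℝ) ∧ y = x then (0 : ℝ) else 1) = A.card - 1 := by
    have h2 : ∀ y ∈ A, (if t < (B.card : ℝ) ∧ y = x then (0 : ℝ) else 1) =
        1 - if y = x then 1 else 0 := by
      intro y _
      by_cases hyx : y = x <;> simp [hyx, ht']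
    rw [sum_congr rfl h2, sum_sub_distrib]
    simp [hx]
  rw [hR, sum_const, nsmul_eq_mul, if_pos ⟨ht', hAB hx⟩]
  have hexp := exp_neg_le_one_sub_half (z := 4 / (B.card : ℝ)) (by positivity)
    (by rw [div_le_one hm]; linarith)
  have h1 : 1 ≤ (A.card : ℝ) * (4 / B.card / 2) := by
    rw [div_div, mul_div_assoc', le_div_iff₀ (by positivity)]
    linarith
  have h2 := mul_le_mul_of_nonneg_left hexp (Nat.cast_nonneg (α := ℝ) A.card)
  linarith

/-- Resampling the colors of all vertices of `N` one after the other. -/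
lemma sum_exp_le_sum_prod_avoids {S N : Finset α} (hN : N ⊆ S) {t : ℝ} (ht : 4 ≤ t) {d : ℕ}
    (hdt : 2 * (d : ℝ) ≤ t) (hd : ∀ u ∈ N, (N.filter (G.Adj u)).card ≤ d) (x : ℕ) :
    ∑ c ∈ colorings G L S, Real.exp (-∑ u ∈ N, colorWeight G L (S \ N) t x c u) ≤
      ∑ c ∈ colorings G L S, ∏ u ∈ N, avoids G L (S \ N) t x c u := by
  have key : ∀ T ⊆ N,
      ∑ c ∈ colorings G L S, Real.exp (-∑ u ∈ N, colorWeight G L (S \ N) t x c u) ≤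
      ∑ c ∈ colorings G L S, (∏ u ∈ T, avoids G L (S \ N) t x c u) *
        ∏ u ∈ N \ T, Real.exp (-colorWeight G L (S \ N) t x c u) := by
    intro T
    induction T using Finset.induction_on with
    | empty =>
      intro _
      refine le_of_eq (sum_congr rfl fun c _ => ?_)
      rw [prod_empty, one_mul, sdiff_empty, ← Real.exp_sum, sum_neg_distrib]
    | insert a T haT ih =>
      intro hT
      have haN : a ∈ N := hT (mem_insert_self a T)
      have haO : a ∉ S \ N := fun h => (mem_sdiff.1 h).2 haN
      refine (ih ((subset_insert a T).trans hT)).trans ?_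
      have h := sum_mul_exp_le_sum_mul_avoids (G := G) (L := L) (S := S) (O := S \ N) (hN haN)
        (fun w hw => mem_erase.2 ⟨ne_of_mem_of_not_mem hw haO, (mem_sdiff.1 hw).1⟩) ht hdt
        (by rw [Finset.sdiff_sdiff_eq_self hN]; exact hd a haN) x
        (fun c => (∏ u ∈ T, avoids G L (S \ N) t x c u) *
          ∏ u ∈ N \ insert a T, Real.exp (-colorWeight G L (S \ N) t x c u))
        (fun c => mul_nonneg (prod_nonneg fun u _ => by unfold avoids; split_ifs <;> simp)
          (prod_nonneg fun u _ => (Real.exp_pos _).le))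
        (fun c y => by
          simp only [avoids, colorWeight, avail_update haO]
          congr 1
          refine prod_congr rfl fun u hu => ?_
          rw [Function.update_of_ne (ne_of_mem_of_not_mem hu haT)])
      have hsplit : N \ T = insert a (N \ insert a T) := by
        ext w
        by_cases hwa : w = a
        · simp [hwa, haN, haT]
        · simp [hwa]
      have hna : a ∉ N \ insert a T := by simp
      refine le_trans (le_of_eq (sum_congr rfl fun c _ => ?_)) (h.trans
        (le_of_eq (sum_congr rfl fun c _ => ?_)))
      · rw [hsplit, prod_insert hna]
        ring
      · rw [prod_insert haT]
        ring
  simpa using key N subset_rfl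

lemma le_sum_exp_colorWeight (N O : Finset α) (t : ℝ) (A : Finset ℕ) (c : α → ℕ)
    (hA : N.card ≤ 2 * A.card) :
    Real.exp (-8) * A.card ≤ ∑ x ∈ A, Real.exp (-∑ u ∈ N, colorWeight G L O t x c u) := by
  have hw : ∀ u ∈ N, ∑ x ∈ A, colorWeight G L O t x c u ≤ 4 := by
    intro u _
    unfold colorWeight
    rw [← sum_filter, sum_const, nsmul_eq_mul]
    set B := avail G L O c u
    have hle : ((A.filter fun x => t < (B.card : ℝ) ∧ x ∈ B).card : ℝ) ≤ B.card := by
      refine Nat.cast_le.2 (card_le_card fun x hx => ?_)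
      exact (mem_filter.1 hx).2.2
    calc _ ≤ (B.card : ℝ) * (4 / B.card) := by gcongr
      _ ≤ 4 := by
        rcases eq_or_ne (B.card : ℝ) 0 with hB | hB
        · simp [hB]
        · rw [mul_div_cancel₀ _ hB]
  have htot : ∑ x ∈ A, ∑ u ∈ N, colorWeight G L O t x c u ≤ 4 * N.card := by
    rw [sum_comm, mul_comm, ← nsmul_eq_mul]
    exact sum_le_card_nsmul _ _ _ hw
  have hA' : (N.card : ℝ) ≤ 2 * A.card := by exact_mod_cast hA
  calc Real.exp (-8) * A.card
      ≤ Real.exp (-8) * ∑ x ∈ A, (9 - ∑ u ∈ N, colorWeight G L O t x c u) := by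
        refine mul_le_mul_of_nonneg_left ?_ (Real.exp_pos _).le
        rw [sum_sub_distrib, sum_const, nsmul_eq_mul]
        linarith
    _ ≤ _ := by
        rw [mul_sum]
        refine sum_le_sum fun x _ => ?_
        have h := Real.add_one_le_exp (8 - ∑ u ∈ N, colorWeight G L O t x c u)
        calc _ ≤ Real.exp (-8) * Real.exp (8 - ∑ u ∈ N, colorWeight G L O t x c u) :=
              mul_le_mul_of_nonneg_left (by linarith) (Real.exp_pos _).le
          _ = _ := by rw [← Real.exp_add]; congr 1; ring

lemma sum_prod_avoids_le {S : Finset α} {v : α} (t : ℝ) (c : α → ℕ) (O : Finset α) :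
    ∑ x ∈ L v, ∏ u ∈ S.filter (G.Adj v), avoids G L O t x c u ≤
      (avail G L S c v).card +
        ∑ u ∈ S.filter (G.Adj v), if t < (avail G L O c u).card then (0 : ℝ) else 1 := by
  set N := S.filter (G.Adj v) with hN
  set short := N.filter fun u => ¬ t < ((avail G L O c u).card : ℝ) with hshort
  have h1 : ∑ u ∈ N, (if t < ((avail G L O c u).card : ℝ) then (0 : ℝ) else 1) = short.card := by
    rw [hshort, card_filter, Nat.cast_sum]
    refine sum_congr rfl fun u _ => ?_
    split_ifs <;> simp_all
  have h2 : ∀ x, ∏ u ∈ N, avoids G L O t x c u ≤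
      if ∀ u ∈ N, ¬ (t < ((avail G L O c u).card : ℝ) ∧ c u = x) then 1 else 0 := by
    intro x
    split_ifs with h
    · refine prod_le_one (fun u _ => ?_) fun u _ => ?_ <;> unfold avoids <;> split_ifs <;> simp
    · push Not at h
      obtain ⟨u, hu, h3⟩ := h
      exact le_of_eq (prod_eq_zero hu (if_pos h3))
  rw [h1]
  refine (sum_le_sum fun x _ => h2 x).trans ?_
  rw [sum_boole]
  have hsub : ((L v).filter fun x => ∀ u ∈ N, ¬ (t < ((avail G L O c u).card : ℝ) ∧ c u = x)) ⊆
      avail G L S c v ∪ short.image c := by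
    intro x hx
    obtain ⟨hx, h⟩ := mem_filter.1 hx
    by_contra hcon
    rw [mem_union, not_or] at hcon
    refine hcon.1 (mem_avail.2 ⟨hx, fun w hw hwv hwx => hcon.2 ?_⟩)
    have hwN : w ∈ N := mem_filter.2 ⟨hw, hwv.symm⟩
    exact mem_image.2 ⟨w, mem_filter.2 ⟨hwN, fun hlt => h w hwN ⟨hlt, hwx⟩⟩, hwx⟩
  exact_mod_cast (card_le_card hsub).trans ((card_union_le _ _).trans
    (Nat.add_le_add_left card_image_le _))

/-- In a locally sparse graph, coloring one more vertex multiplies the number of colorings. -/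
lemma mul_card_colorings_le {D d : ℕ} (hD : ∀ v, (univ.filter (G.Adj v)).card ≤ D)
    (hd : ∀ v u, G.Adj v u → (univ.filter fun w => G.Adj v w ∧ G.Adj u w).card ≤ d)
    (hL : ∀ v, D ≤ 2 * (L v).card) (hdD : 32 * (d : ℝ) ≤ Real.exp (-8) ^ 2 * D)
    (hDlarge : 64 ≤ Real.exp (-8) ^ 2 * D) (S : Finset α) :
    ∀ v ∉ S, Real.exp (-8) * D / 4 * (colorings G L S).card ≤
      ((colorings G L (insert v S)).card : ℝ) := by
  induction S using Finset.strongInduction with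
  | H S ih =>
  intro v hv
  set ε := Real.exp (-8) with hε
  have hε0 : 0 < ε := Real.exp_pos _
  set N := S.filter (G.Adj v) with hN
  set t : ℝ := ε ^ 2 * D / 16 with ht
  set M : ℝ := ((colorings G L S).card : ℝ) with hM
  have hM0 : 0 ≤ M := Nat.cast_nonneg _
  have hNS : N ⊆ S := filter_subset _ _
  have hND : N.card ≤ D := (card_le_card (filter_subset_filter _ (subset_univ S))).trans (hD v)
  have hshort : ∀ u ∈ N, ∑ c ∈ colorings G L S,
      (if t < (avail G L (S \ N) c u).card then (0 : ℝ) else 1) ≤ ε / 4 * M := by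
    intro u hu
    have huS : u ∈ S := hNS hu
    refine (sum_short_le huS (fun w hw => ?_) (by positivity)).trans ?_
    · rw [mem_sdiff] at hw
      exact mem_erase.2 ⟨fun h => hw.2 (h ▸ hu), hw.1⟩
    · have h := ih (S.erase u) (erase_ssubset huS) u (notMem_erase u S)
      rw [insert_erase huS] at h
      have h' := mul_le_mul_of_nonneg_left h (by positivity : 0 ≤ ε / 4)
      refine le_trans (le_of_eq ?_) h'
      rw [ht]
      ring
  have hshort' : ∑ c ∈ colorings G L S, ∑ u ∈ N,
      (if t < (avail G L (S \ N) c u).card then (0 : ℝ) else 1) ≤ D * (ε / 4 * M) := by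
    rw [sum_comm]
    refine (sum_le_card_nsmul _ _ _ hshort).trans ?_
    rw [nsmul_eq_mul]
    gcongr
  have hlong : ε * (L v).card * M ≤
      ∑ c ∈ colorings G L S, ∑ x ∈ L v, ∏ u ∈ N, avoids G L (S \ N) t x c u := by
    calc ε * (L v).card * M = ∑ c ∈ colorings G L S, ε * (L v).card := by
          rw [sum_const, nsmul_eq_mul, mul_comm]
      _ ≤ ∑ c ∈ colorings G L S, ∑ x ∈ L v,
            Real.exp (-∑ u ∈ N, colorWeight G L (S \ N) t x c u) :=
          sum_le_sum fun c _ => le_sum_exp_colorWeight N (S \ N) t (L v) c (hND.trans (hL v))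
      _ ≤ _ := by
          rw [sum_comm]
          refine (sum_le_sum fun x _ => ?_).trans (le_of_eq sum_comm)
          refine sum_exp_le_sum_prod_avoids hNS (d := d) (by linarith) (by linarith) ?_ x
          intro u hu
          refine (card_le_card fun w hw => ?_).trans (hd v u (mem_filter.1 hu).2)
          simp only [hN, mem_filter] at hw
          simp [hw.1.2, hw.2]
  have hle := hlong.trans (sum_le_sum fun c _ =>
    sum_prod_avoids_le (G := G) (L := L) (S := S) (v := v) t c (S \ N))
  rw [sum_add_distrib] at hle
  rw [card_colorings_insert hv]
  have hL' : (D : ℝ) ≤ 2 * (L v).card := by exact_mod_cast hL v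
  have h5 : ε * M * D ≤ ε * M * (2 * (L v).card) :=
    mul_le_mul_of_nonneg_left hL' (by positivity)
  linarith

/-- A graph of maximum degree at most `D` all of whose neighborhoods are sparse can be colored
from lists of size `D / 2`. -/
theorem exists_listColoring_of_locallySparse {D d : ℕ}
    (hD : ∀ v, (univ.filter (G.Adj v)).card ≤ D)
    (hd : ∀ v u, G.Adj v u → (univ.filter fun w => G.Adj v w ∧ G.Adj u w).card ≤ d)
    (hL : ∀ v, D ≤ 2 * (L v).card) (hdD : 32 * (d : ℝ) ≤ Real.exp (-8) ^ 2 * D)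
    (hDlarge : 64 ≤ Real.exp (-8) ^ 2 * D) :
    ∃ c : α → ℕ, (∀ v, c v ∈ L v) ∧ ∀ u v, G.Adj u v → c u ≠ c v := by
  have hD0 : (0 : ℝ) < D := by
    by_contra! h
    nlinarith [sq_nonneg (Real.exp (-8))]
  have hpos : ∀ S : Finset α, 0 < ((colorings G L S).card : ℝ) := by
    intro S
    induction S using Finset.induction_on with
    | empty =>
      have : (fun _ => 0 : α → ℕ) ∈ colorings G L ∅ := by simp [mem_colorings]
      exact_mod_cast card_pos.2 ⟨_, this⟩
    | insert v S hv ih =>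
      refine lt_of_lt_of_le ?_ (mul_card_colorings_le hD hd hL hdD hDlarge S v hv)
      have := Real.exp_pos (-8)
      positivity
  obtain ⟨c, hc⟩ := card_pos.1 (Nat.cast_pos.1 (hpos univ))
  rw [mem_colorings] at hc
  exact ⟨c, fun v => hc.1.1 v (mem_univ v), fun u v => hc.2 u (mem_univ u) v (mem_univ v)⟩

end LocallySparse

/-! ### The line graph of a linear hypergraph -/

/-- The line graph: two distinct edges are adjacent if they intersect. -/
def lineGraph (E : Finset (Finset V)) : SimpleGraph E where
  Adj e f := e ≠ f ∧ ¬ Disjoint (e : Finset V) f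
  symm := ⟨fun _ _ h => ⟨h.1.symm, fun hd => h.2 hd.symm⟩⟩
  loopless := ⟨fun _ h => h.1 rfl⟩

instance (E : Finset (Finset V)) : DecidableRel (lineGraph E).Adj := fun e f =>
  inferInstanceAs (Decidable (e ≠ f ∧ ¬ Disjoint (e : Finset V) f))

lemma card_filter_lineGraph_adj_le {E : Finset (Finset V)} {P Δ : ℕ} (hP : ∀ e ∈ E, e.card ≤ P)
    (hΔ : ∀ x, deg E x ≤ Δ) (e : E) :
    (univ.filter ((lineGraph E).Adj e)).card ≤ P * Δ := by
  rw [← card_map (Function.Embedding.subtype (· ∈ E))]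
  have hsub : (univ.filter ((lineGraph E).Adj e)).map (Function.Embedding.subtype (· ∈ E)) ⊆
      (e : Finset V).biUnion fun x => E.filter fun f => x ∈ f := by
    intro f hf
    obtain ⟨f, hef, rfl⟩ := mem_map.1 hf
    obtain ⟨x, hxe, hxf⟩ := not_disjoint_iff.1 ((mem_filter_univ f).1 hef).2
    exact mem_biUnion.2 ⟨x, hxe, mem_filter.2 ⟨f.2, hxf⟩⟩
  refine (card_le_card hsub).trans ((card_biUnion_le_card_mul _ _ Δ fun x _ => hΔ x).trans ?_)
  exact Nat.mul_le_mul_right _ (hP e e.2)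

lemma Linear.card_filter_mem_mem_le_one {E : Finset (Finset V)} (hE : Linear E) {y z : V}
    (hyz : y ≠ z) : (E.filter fun g => y ∈ g ∧ z ∈ g).card ≤ 1 := by
  refine card_le_one.2 fun g hg g' hg' => ?_
  rw [mem_filter] at hg hg'
  by_contra hne
  have h := card_le_one.1 (hE g hg.1 g' hg'.1 hne) y (by simp [hg.2, hg'.2]) z
    (by simp [hg.2, hg'.2])
  exact hyz h

lemma Linear.card_common_neighbors_le {E : Finset (Finset V)} (hE : Linear E) {P Δ : ℕ}
    (hP : ∀ e ∈ E, e.card ≤ P) (hΔ : ∀ x, deg E x ≤ Δ) (e f : E) (hef : (lineGraph E).Adj e f) :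
    (univ.filter fun g => (lineGraph E).Adj e g ∧ (lineGraph E).Adj f g).card ≤
      Δ + P * P := by
  obtain ⟨hne, hmeet⟩ := hef
  obtain ⟨x, hxe, hxf⟩ := not_disjoint_iff.1 hmeet
  have hx : ∀ y ∈ (e : Finset V), y ∈ (f : Finset V) → y = x := fun y hye hyf =>
    card_le_one.1 (hE e e.2 f f.2 fun h => hne (Subtype.ext h)) y (by simp [hye, hyf]) x
      (by simp [hxe, hxf])
  rw [← card_map (Function.Embedding.subtype (· ∈ E))]
  set pairs := ((e : Finset V).erase x) ×ˢ ((f : Finset V).erase x) with hpairs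
  have hsub : (univ.filter fun g => (lineGraph E).Adj e g ∧ (lineGraph E).Adj f g).map
      (Function.Embedding.subtype (· ∈ E)) ⊆ (E.filter fun g => x ∈ g) ∪
        pairs.biUnion fun p => E.filter fun g => p.1 ∈ g ∧ p.2 ∈ g := by
    intro g hg
    obtain ⟨g, hadj, rfl⟩ := mem_map.1 hg
    obtain ⟨hg1, hg2⟩ := (mem_filter_univ g).1 hadj
    obtain ⟨y, hye, hyg⟩ := not_disjoint_iff.1 hg1.2
    obtain ⟨z, hzf, hzg⟩ := not_disjoint_iff.1 hg2.2
    by_cases hxg : x ∈ (g : Finset V)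
    · exact mem_union_left _ (mem_filter.2 ⟨g.2, hxg⟩)
    · refine mem_union_right _ (mem_biUnion.2 ⟨(y, z), mem_product.2 ⟨mem_erase.2 ⟨?_, hye⟩,
        mem_erase.2 ⟨?_, hzf⟩⟩, mem_filter.2 ⟨g.2, hyg, hzg⟩⟩)
      · rintro rfl
        exact hxg hyg
      · rintro rfl
        exact hxg hzg
  refine (card_le_card hsub).trans ((card_union_le _ _).trans (Nat.add_le_add (hΔ x) ?_))
  refine (card_biUnion_le_card_mul _ _ 1 fun p hp => ?_).trans ?_
  · obtain ⟨h1, h2⟩ := mem_product.1 hp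
    refine hE.card_filter_mem_mem_le_one fun h => ?_
    exact (mem_erase.1 h1).1 (hx _ (mem_erase.1 h1).2 (h ▸ (mem_erase.1 h2).2))
  · rw [mul_one, hpairs, card_product]
    exact Nat.mul_le_mul ((card_le_card (erase_subset _ _)).trans (hP e e.2))
      ((card_le_card (erase_subset _ _)).trans (hP f f.2))

lemma Linear.deg_mul_lt_card [Fintype V] {E : Finset (Finset V)} (hE : Linear E) {P : ℕ}
    (hP : ∀ e ∈ E, e.card = P) (x : V) : deg E x * (P - 1) < Fintype.card V := by
  have hdisj : ∀ e ∈ E.filter (x ∈ ·), ∀ f ∈ E.filter (x ∈ ·), e ≠ f →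
      Disjoint (e.erase x) (f.erase x) := by
    intro e he f hf hef
    rw [mem_filter] at he hf
    refine disjoint_left.2 fun y hye hyf => (mem_erase.1 hye).1 ?_
    exact card_le_one.1 (hE e he.1 f hf.1 hef) y
      (mem_inter.2 ⟨(mem_erase.1 hye).2, (mem_erase.1 hyf).2⟩) x (mem_inter.2 ⟨he.2, hf.2⟩)
  have hcard : ((E.filter (x ∈ ·)).biUnion fun e => e.erase x).card = deg E x * (P - 1) := by
    rw [card_biUnion hdisj]
    refine sum_const_nat fun e he => ?_
    rw [mem_filter] at he
    rw [card_erase_of_mem he.2, hP e he.1]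
  rw [← hcard, ← card_univ]
  refine card_lt_card (ssubset_univ_iff.2 fun h => ?_)
  have : x ∈ (E.filter (x ∈ ·)).biUnion fun e => e.erase x := h ▸ mem_univ x
  simp at this

lemma Linear.listColorable {E : Finset (Finset V)} (hE : Linear E) {P Δ k : ℕ}
    (hP : ∀ e ∈ E, e.card ≤ P) (hΔ : ∀ x, deg E x ≤ Δ) (hk : P * Δ ≤ 2 * k)
    (hP' : 10 ^ 10 ≤ P) (hΔ' : 10 ^ 10 * (P - 1) ≤ Δ) : ListColorable E k := by
  intro L hL
  have hsparse : 10 ^ 10 * (Δ + P * P) ≤ 3 * (P * Δ) := by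
    have h1 : P * (10 ^ 10 * (P - 1)) ≤ P * Δ := Nat.mul_le_mul_left _ hΔ'
    have h2 : 10 ^ 10 * Δ ≤ P * Δ := Nat.mul_le_mul_right _ hP'
    have h3 : P * P ≤ P * (2 * (P - 1)) := Nat.mul_le_mul_left _ (by omega)
    nlinarith
  have hexp : (1 / 43046721 : ℝ) ≤ Real.exp (-8) ^ 2 := by
    have h3 : Real.exp 1 ≤ 3 := Real.exp_one_lt_three.le
    rw [← Real.exp_nat_mul, show ((2 : ℕ) : ℝ) * -8 = -((16 : ℕ) * 1) by norm_num, Real.exp_neg,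
      Real.exp_nat_mul, one_div]
    refine inv_anti₀ (by positivity) ?_
    calc Real.exp 1 ^ 16 ≤ 3 ^ 16 := by gcongr
      _ = 43046721 := by norm_num
  have hsparse' : (10 : ℝ) ^ 10 * ((Δ + P * P : ℕ) : ℝ) ≤ 3 * ((P * Δ : ℕ) : ℝ) := by
    exact_mod_cast hsparse
  have hone : (1 : ℝ) ≤ ((Δ + P * P : ℕ) : ℝ) := by
    have : 1 ≤ P * P := Nat.one_le_iff_ne_zero.2 (by simp; omega)
    exact_mod_cast this.trans (Nat.le_add_left _ _)
  have hmul := mul_le_mul_of_nonneg_right hexp (Nat.cast_nonneg (α := ℝ) (P * Δ))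
  obtain ⟨c, hc1, hc2⟩ := exists_listColoring_of_locallySparse (G := lineGraph E)
    (L := fun e : E => L e) (card_filter_lineGraph_adj_le hP hΔ)
    (fun e f => hE.card_common_neighbors_le hP hΔ e f)
    (fun e => by rw [hL e e.2]; exact hk) (by linarith) (by linarith)
  refine ⟨fun e => if h : e ∈ E then c ⟨e, h⟩ else 0, fun e he => ?_, fun e he f hf hef hγ => ?_⟩
  · simpa [he] using hc1 ⟨e, he⟩
  · by_contra hdisj
    simp only [he, hf, dif_pos] at hγ
    exact hc2 ⟨e, he⟩ ⟨f, hf⟩ ⟨fun h => hef (congrArg Subtype.val h), hdisj⟩ hγ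

/-- There is a universal constant `C ≥ 3` such that every linear hypergraph on `n`
vertices with no rank-1 edges, maximum rank `P ≥ C` and maximum degree `Δ ≥ C(P - 1)`
which is uniform or satisfies `n > Δ(P - 1)` has `q_list(H) ≤ n - 1`. -/
theorem stmt6 :
    ∃ C : ℕ, 3 ≤ C ∧
      ∀ (V : Type) [DecidableEq V] [Fintype V] (E : Finset (Finset V)) (P Δ : ℕ),
        Linear E → (∀ e ∈ E, 2 ≤ e.card) →
        P = E.sup Finset.card → Δ = Finset.univ.sup (deg E) →
        C ≤ P → C * (P - 1) ≤ Δ →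
        ((∀ e ∈ E, ∀ f ∈ E, e.card = f.card) ∨ Δ * (P - 1) < Fintype.card V) →
        qList E ≤ Fintype.card V - 1 := by
  refine ⟨10 ^ 10, by norm_num, ?_⟩
  intro V _ _ E P Δ hE _ hP hΔ hCP hCΔ h
  have hP' : ∀ e ∈ E, e.card ≤ P := fun e he => hP ▸ le_sup (f := Finset.card) he
  have hΔ' : ∀ x, deg E x ≤ Δ := fun x => hΔ ▸ le_sup (f := deg E) (mem_univ x)
  have hn : Δ * (P - 1) < Fintype.card V := by
    refine h.elim (fun hunif => ?_) id
    have hΔ0 : 0 < Δ := by omega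
    have huniv : (univ : Finset V).Nonempty := by
      rw [nonempty_iff_ne_empty]
      intro hempty
      simp [hempty] at hΔ
      omega
    obtain ⟨x, -, hx⟩ := exists_mem_eq_sup univ huniv (deg E)
    rw [hΔ, hx]
    refine hE.deg_mul_lt_card (fun e he => ?_) x
    obtain ⟨f, hf, hfP⟩ := exists_mem_eq_sup E ⟨e, he⟩ Finset.card
    rw [hP, hfP, hunif e he f hf]
  refine Nat.sInf_le (hE.listColorable hP' hΔ' ?_ hCP hCΔ)
  have h2 : P * Δ ≤ 2 * (P - 1) * Δ := Nat.mul_le_mul_right _ (by omega)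
  have h3 : 2 * (P - 1) * Δ = 2 * (Δ * (P - 1)) := by ring
  omega
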